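/- arXiv:2410.18753 — 2 statements merged into one kernel-verified Lean document; each statement's English description precedes it below -/
import Mathlib

section
/- Let k ∈ ℕ₊ and let X ⊆ ℕ^k ⊆ ℤ^k be a polyhedral set. Then the growth series of X with respect to the ℓ¹ metric, ∑_{n=0}^∞ #{x ∈ X : |x|_{ℓ¹} ≤ n} · z^n ∈ ℚ[[z]], is a rational function: there exist polynomials p, q ∈ ℚ[z] with q(0) ≠ 0 such that q · (∑_{n=0}^∞ #{x ∈ X : |x|_{ℓ¹} ≤ n} z^n) = p as formal power series. -/
/-- An elementary subset of `ℤ^k`: solutions of `u·z = a`, `u·z ≡ a mod b` (with `b > 0`),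
or `u·z > a`, for integer data. -/
def IsElementary {k : ℕ} (S : Set (Fin k → ℤ)) : Prop :=
  (∃ (u : Fin k → ℤ) (a : ℤ), S = {z : Fin k → ℤ | ∑ i, u i * z i = a}) ∨
  (∃ (u : Fin k → ℤ) (a : ℤ) (b : ℕ), 0 < b ∧
      S = {z : Fin k → ℤ | (b : ℤ) ∣ (∑ i, u i * z i) - a}) ∨
  (∃ (u : Fin k → ℤ) (a : ℤ), S = {z : Fin k → ℤ | a < ∑ i, u i * z i})

/-- A basic polyhedral subset of `ℤ^k`: a finite intersection of elementary sets. -/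
def IsBasicPolyhedral {k : ℕ} (S : Set (Fin k → ℤ)) : Prop :=
  ∃ (n : ℕ) (E : Fin n → Set (Fin k → ℤ)), (∀ i, IsElementary (E i)) ∧ S = ⋂ i, E i

/-- A polyhedral subset of `ℤ^k`: a finite union of basic polyhedral sets. -/
def IsPolyhedral {k : ℕ} (S : Set (Fin k → ℤ)) : Prop :=
  ∃ (n : ℕ) (B : Fin n → Set (Fin k → ℤ)), (∀ i, IsBasicPolyhedral (B i)) ∧ S = ⋃ i, B i

/-- A power series is rational if some polynomial with nonzero constant coefficient multiplies it
to a polynomial. -/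
def IsRationalSeries (F : PowerSeries ℚ) : Prop :=
  ∃ p q : Polynomial ℚ, q.coeff 0 ≠ 0 ∧ (q : PowerSeries ℚ) * F = (p : PowerSeries ℚ)

namespace IsRationalSeries

theorem zero : IsRationalSeries 0 :=
  ⟨0, 1, by simp, by simp⟩

theorem add {F G : PowerSeries ℚ} (hF : IsRationalSeries F) (hG : IsRationalSeries G) :
    IsRationalSeries (F + G) := by
  obtain ⟨p, q, hq, h⟩ := hF
  obtain ⟨p', q', hq', h'⟩ := hG
  refine ⟨q' * p + q * p', q * q', by simp [Polynomial.mul_coeff_zero, hq, hq'], ?_⟩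
  push_cast
  rw [← h, ← h']
  ring

theorem of_mul {F : PowerSeries ℚ} {r : Polynomial ℚ} (hr : r.coeff 0 ≠ 0)
    (h : IsRationalSeries ((r : PowerSeries ℚ) * F)) : IsRationalSeries F := by
  obtain ⟨p, q, hq, h⟩ := h
  refine ⟨p, q * r, by simp [Polynomial.mul_coeff_zero, hq, hr], ?_⟩
  push_cast
  rw [mul_assoc, h]

end IsRationalSeries

section Growth

variable {k : ℕ}

theorem finite_sum_le (S : Set (Fin k → ℕ)) (n : ℕ) : {x ∈ S | ∑ i, x i ≤ n}.Finite := by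
  refine (Set.finite_Iic (fun _ : Fin k => n)).subset fun x hx i => ?_
  exact (Finset.single_le_sum (fun j _ => Nat.zero_le (x j)) (Finset.mem_univ i)).trans hx.2

/-- The growth series of a subset of `ℕ^k` with respect to the `ℓ¹` metric. -/
noncomputable def growthSeries (S : Set (Fin k → ℕ)) : PowerSeries ℚ :=
  PowerSeries.mk fun n => (Set.ncard {x ∈ S | ∑ i, x i ≤ n} : ℚ)

theorem growthSeries_empty : growthSeries (∅ : Set (Fin k → ℕ)) = 0 := by
  ext n
  simp [growthSeries]

theorem growthSeries_union {S T : Set (Fin k → ℕ)} (h : Disjoint S T) :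
    growthSeries (S ∪ T) = growthSeries S + growthSeries T := by
  ext n
  simp only [growthSeries, PowerSeries.coeff_mk, map_add]
  rw [← Nat.cast_add, ← Set.ncard_union_eq _ (finite_sum_le S n) (finite_sum_le T n)]
  · congr 2
    ext x
    simp only [Set.mem_union, Set.mem_ofPred_eq]
    tauto
  · exact h.mono (fun x hx => hx.1) (fun x hx => hx.1)

theorem growthSeries_image_add (a : Fin k → ℕ) (S : Set (Fin k → ℕ)) :
    growthSeries ((fun x => a + x) '' S) = PowerSeries.X ^ (∑ i, a i) * growthSeries S := by
  ext n
  simp only [growthSeries, PowerSeries.coeff_X_pow_mul', PowerSeries.coeff_mk]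
  split_ifs with h
  · rw [← Set.ncard_image_of_injective {x ∈ S | _} (add_right_injective a)]
    congr 2
    ext x
    simp only [Set.mem_image, Set.mem_ofPred_eq]
    constructor
    · rintro ⟨⟨y, hy, rfl⟩, hn⟩
      simp only [Pi.add_apply, Finset.sum_add_distrib] at hn
      exact ⟨y, ⟨hy, by omega⟩, rfl⟩
    · rintro ⟨y, ⟨hy, hn⟩, rfl⟩
      refine ⟨⟨y, hy, rfl⟩, ?_⟩
      simp only [Pi.add_apply, Finset.sum_add_distrib]
      omega
  · rw [Nat.cast_eq_zero, Set.ncard_eq_zero (finite_sum_le _ n), Set.eq_empty_iff_forall_notMem]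
    rintro _ ⟨⟨y, hy, rfl⟩, hn⟩
    simp only [Pi.add_apply, Finset.sum_add_distrib] at hn
    omega

theorem isRationalSeries_growthSeries_singleton (a : Fin k → ℕ) :
    IsRationalSeries (growthSeries {a}) := by
  refine ⟨Polynomial.X ^ (∑ i, a i), 1 - Polynomial.X, by simp, ?_⟩
  have h : growthSeries ({0} : Set (Fin k → ℕ)) = PowerSeries.mk 1 := by
    ext n
    simp only [growthSeries, PowerSeries.coeff_mk, Pi.one_apply, Nat.cast_eq_one,
      Set.ncard_eq_one]
    refine ⟨0, Set.ext fun x => ?_⟩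
    simp only [Set.mem_singleton_iff, Set.mem_ofPred_eq, and_iff_left_iff_imp]
    rintro rfl
    simp
  have h' := growthSeries_image_add a {0}
  rw [Set.image_singleton, add_zero, h] at h'
  rw [h']
  push_cast
  rw [mul_left_comm, mul_comm (1 - _), PowerSeries.mk_one_mul_one_sub_eq_one, mul_one]

end Growth

/-- Injective affine maps between free commutative monoids of finite rank. -/
def IsAffineEmbedding {m n : ℕ} (φ : (Fin m → ℕ) → Fin n → ℕ) : Prop :=
  Function.Injective φ ∧
    ∃ (a : Fin n → ℕ) (f : (Fin m → ℕ) →+ (Fin n → ℕ)), ∀ y, φ y = a + f y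

namespace IsAffineEmbedding

variable {l m n : ℕ}

theorem id : IsAffineEmbedding (fun y : Fin n → ℕ => y) :=
  ⟨fun _ _ h => h, 0, AddMonoidHom.id _, fun y => by simp⟩

theorem comp {ψ : (Fin m → ℕ) → Fin n → ℕ} {φ : (Fin l → ℕ) → Fin m → ℕ}
    (hψ : IsAffineEmbedding ψ) (hφ : IsAffineEmbedding φ) : IsAffineEmbedding (ψ ∘ φ) := by
  obtain ⟨hψ, a, f, hf⟩ := hψ
  obtain ⟨hφ, b, g, hg⟩ := hφ
  refine ⟨hψ.comp hφ, a + f b, f.comp g, fun y => ?_⟩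
  simp [hf, hg, add_assoc]

theorem insertNth_zero (i : Fin (n + 1)) :
    IsAffineEmbedding (fun y : Fin n → ℕ => (i.insertNth 0 y : Fin (n + 1) → ℕ)) := by
  refine ⟨Fin.insertNth_right_injective (α := fun _ => ℕ) (p := i) (x := 0), 0,
    ⟨⟨fun y => (i.insertNth 0 y : Fin (n + 1) → ℕ), ?_⟩, ?_⟩, ?_⟩
  · funext j
    refine i.succAboveCases ?_ (fun j => ?_) j <;> simp
  · intro x y
    funext j
    refine i.succAboveCases ?_ (fun j => ?_) j <;> simp
  · simp

theorem add_single_one (i : Fin n) :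
    IsAffineEmbedding (fun y : Fin n → ℕ => y + Pi.single i 1) :=
  ⟨add_left_injective _, Pi.single i 1, AddMonoidHom.id _, fun y => by simp [add_comm]⟩

theorem add_single_apply {i j : Fin n} (h : i ≠ j) :
    IsAffineEmbedding (fun y : Fin n → ℕ => y + Pi.single i (y j)) := by
  refine ⟨fun x y hxy => ?_, 0,
    AddMonoidHom.id _ + (AddMonoidHom.single (fun _ => ℕ) i).comp (Pi.evalAddMonoidHom _ j),
    fun y => by simp⟩
  have hj : x j = y j := by simpa [h.symm] using congrFun hxy j
  simpa [hj] using hxy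

theorem add_mul {d r : Fin n → ℕ} (hd : ∀ i, 0 < d i) :
    IsAffineEmbedding (fun y : Fin n → ℕ => r + d * y) := by
  refine ⟨fun x y h => ?_, r, AddMonoidHom.mulLeft d, fun y => rfl⟩
  have h := add_left_cancel (a := r) h
  funext i
  exact Nat.eq_of_mul_eq_mul_left (hd i) (congrFun h i)

end IsAffineEmbedding

theorem isRationalSeries_growthSeries_range {m n : ℕ} {φ : (Fin m → ℕ) → Fin n → ℕ}
    (hφ : IsAffineEmbedding φ) : IsRationalSeries (growthSeries (Set.range φ)) := by
  induction m with
  | zero =>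
    rw [Set.range_unique]
    exact isRationalSeries_growthSeries_singleton _
  | succ m ih =>
    have hS := ih (hφ.comp (IsAffineEmbedding.insertNth_zero 0))
    obtain ⟨hinj, a, f, hf⟩ := hφ
    set v := f (Pi.single 0 1) with hv
    have hadd (y) : φ (y + Pi.single 0 1) = v + φ y := by
      rw [hf, hf, map_add, hv]
      abel
    have hv0 : 0 < ∑ i, v i := by
      rw [Nat.pos_iff_ne_zero]
      intro h0
      have hv0 : v = 0 := by
        funext i
        simpa using (Finset.sum_eq_zero_iff.1 h0) i (Finset.mem_univ i)
      have := hinj ((hadd 0).trans (by rw [hv0, zero_add]))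
      simpa using congrFun this 0
    have hdecomp : Set.range φ =
        Set.range (φ ∘ fun y : Fin m → ℕ => ((0 : Fin (m + 1)).insertNth 0 y : Fin (m + 1) → ℕ)) ∪
          (fun x => v + x) '' Set.range φ := by
      ext x
      constructor
      · rintro ⟨y, rfl⟩
        rcases Nat.eq_zero_or_pos (y 0) with h | h
        · refine Or.inl ⟨fun j => y j.succ, congrArg φ ?_⟩
          funext j
          refine Fin.cases ?_ (fun j => ?_) j <;> simp [h]
        · refine Or.inr ⟨_, ⟨y - Pi.single 0 1, rfl⟩, ?_⟩
          refine (hadd _).symm.trans (congrArg φ (tsub_add_cancel_of_le fun j => ?_))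
          rcases eq_or_ne j 0 with rfl | hj
          · simpa using Nat.one_le_iff_ne_zero.2 h.ne'
          · simp [hj]
      · rintro (⟨y, rfl⟩ | ⟨_, ⟨y, rfl⟩, rfl⟩)
        · exact ⟨_, rfl⟩
        · exact ⟨_, hadd y⟩
    have hdisj : Disjoint
        (Set.range (φ ∘ fun y : Fin m → ℕ => ((0 : Fin (m + 1)).insertNth 0 y : Fin (m + 1) → ℕ)))
        ((fun x => v + x) '' Set.range φ) := by
      rw [Set.disjoint_left]
      rintro _ ⟨y, rfl⟩ ⟨_, ⟨z, rfl⟩, h⟩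
      have := congrFun (hinj ((hadd z).trans h)) 0
      simp at this
    have hG := congrArg growthSeries hdecomp
    rw [growthSeries_union hdisj, growthSeries_image_add] at hG
    refine IsRationalSeries.of_mul (r := 1 - Polynomial.X ^ ∑ i, v i)
      (by simp [Polynomial.coeff_X_pow, hv0.ne]) ?_
    convert hS using 1
    push_cast
    rw [sub_mul, one_mul, sub_eq_iff_eq_add]
    exact hG

/-- Finite disjoint unions of images of free commutative monoids under affine embeddings. -/
inductive IsSemisimple {n : ℕ} : Set (Fin n → ℕ) → Prop
  | empty : IsSemisimple ∅
  | range {m : ℕ} {φ : (Fin m → ℕ) → Fin n → ℕ} (hφ : IsAffineEmbedding φ) :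
      IsSemisimple (Set.range φ)
  | union {S T : Set (Fin n → ℕ)} (hS : IsSemisimple S) (hT : IsSemisimple T)
      (h : Disjoint S T) : IsSemisimple (S ∪ T)

namespace IsSemisimple

variable {m n : ℕ}

theorem isRationalSeries_growthSeries {S : Set (Fin n → ℕ)} (hS : IsSemisimple S) :
    IsRationalSeries (growthSeries S) := by
  induction hS with
  | empty => rw [growthSeries_empty]; exact .zero
  | range hφ => exact isRationalSeries_growthSeries_range hφ
  | union _ _ h ihS ihT => rw [growthSeries_union h]; exact ihS.add ihT

theorem univ : IsSemisimple (Set.univ : Set (Fin n → ℕ)) := by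
  simpa using range (IsAffineEmbedding.id (n := n))

theorem image {φ : (Fin m → ℕ) → Fin n → ℕ} (hφ : IsAffineEmbedding φ) {S : Set (Fin m → ℕ)}
    (hS : IsSemisimple S) : IsSemisimple (φ '' S) := by
  induction hS with
  | empty => rw [Set.image_empty]; exact empty
  | range hψ => rw [← Set.range_comp]; exact range (hφ.comp hψ)
  | union _ _ h ihS ihT =>
    rw [Set.image_union]
    exact union ihS ihT ((Set.disjoint_image_iff hφ.1).2 h)

theorem biUnion {α : Type} (s : Finset α) {T : α → Set (Fin n → ℕ)}
    (hT : ∀ i ∈ s, IsSemisimple (T i)) (h : (s : Set α).PairwiseDisjoint T) :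
    IsSemisimple (⋃ i ∈ s, T i) := by
  classical
  induction s using Finset.induction_on with
  | empty => simpa using empty
  | insert a s ha ih =>
    rw [Finset.set_biUnion_insert]
    rw [Finset.coe_insert, Set.pairwiseDisjoint_insert_of_notMem (by simpa using ha)] at h
    refine union (hT a (by simp)) (ih (fun i hi => hT i (by simp [hi])) h.1) ?_
    rw [Set.disjoint_iUnion₂_right]
    exact fun i hi => h.2 i hi

theorem of_preimage {l : ℕ} {φ : (Fin l → ℕ) → Fin n → ℕ} {ψ : (Fin m → ℕ) → Fin n → ℕ}
    (hφ : IsAffineEmbedding φ) (hψ : IsAffineEmbedding ψ)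
    (h : IsCompl (Set.range φ) (Set.range ψ)) {S : Set (Fin n → ℕ)}
    (h₁ : IsSemisimple (φ ⁻¹' S)) (h₂ : IsSemisimple (ψ ⁻¹' S)) : IsSemisimple S := by
  convert union (h₁.image hφ) (h₂.image hψ)
    (h.disjoint.mono (Set.image_subset_range _ _) (Set.image_subset_range _ _))
  rw [Set.image_preimage_eq_inter_range, Set.image_preimage_eq_inter_range,
    ← Set.inter_union_distrib_left]
  exact (Set.inter_eq_left.2 fun x _ => h.sup_eq_top.ge trivial).symm

/-- Semisimplicity can be checked on the residue classes of a box. -/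
theorem of_residues {d : Fin n → ℕ} (hd : ∀ i, 0 < d i) {S : Set (Fin n → ℕ)}
    (h : ∀ r : Fin n → ℕ, IsSemisimple {y | r + d * y ∈ S}) : IsSemisimple S := by
  convert biUnion (Fintype.piFinset fun i => Finset.range (d i))
    (T := fun r => (fun y => r + d * y) '' {y | r + d * y ∈ S})
    (fun r _ => (h r).image (IsAffineEmbedding.add_mul hd)) ?_
  · ext x
    simp only [Set.mem_iUnion, Set.mem_image, Set.mem_ofPred_eq, Fintype.mem_piFinset,
      Finset.mem_range]
    constructor
    · intro hx
      have hx' : (fun i => x i % d i) + d * (fun i => x i / d i) = x :=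
        funext fun i => Nat.mod_add_div (x i) (d i)
      exact ⟨fun i => x i % d i, fun i => Nat.mod_lt _ (hd i), fun i => x i / d i,
        by rwa [hx'], hx'⟩
    · rintro ⟨r, -, y, hy, rfl⟩
      exact hy
  · intro r hr s hs hrs
    rw [Function.onFun, Set.disjoint_left]
    rintro _ ⟨y, -, rfl⟩ ⟨z, -, hz⟩
    refine hrs (funext fun i => ?_)
    simp only [Finset.mem_coe, Fintype.mem_piFinset, Finset.mem_range] at hr hs
    have := congrArg (· % d i) (congrFun hz i)
    simpa [Nat.mod_eq_of_lt (hr i), Nat.mod_eq_of_lt (hs i)] using this.symm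

end IsSemisimple

section HalfSpace

variable {n : ℕ}

theorem isCompl_range_insertNth_zero (i : Fin (n + 1)) :
    IsCompl (Set.range fun y : Fin n → ℕ => (i.insertNth 0 y : Fin (n + 1) → ℕ))
      (Set.range fun y : Fin (n + 1) → ℕ => y + Pi.single i 1) := by
  rw [← compl_eq_iff_isCompl]
  ext x
  rw [Set.mem_compl_iff]
  have h₁ : x ∈ Set.range (fun y : Fin n → ℕ => (i.insertNth 0 y : Fin (n + 1) → ℕ)) ↔
      x i = 0 := by
    constructor
    · rintro ⟨y, rfl⟩
      simp
    · intro h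
      refine ⟨fun j => x (i.succAbove j), funext fun j => ?_⟩
      refine i.succAboveCases ?_ (fun j => ?_) j <;> simp [h]
  rw [h₁]
  constructor
  · intro h
    refine ⟨x - Pi.single i 1, tsub_add_cancel_of_le fun j => ?_⟩
    rcases eq_or_ne j i with rfl | hj
    · simpa using Nat.one_le_iff_ne_zero.2 h
    · simp [hj]
  · rintro ⟨y, rfl⟩
    simp

theorem isCompl_range_add_single {i j : Fin n} (h : i ≠ j) :
    IsCompl (Set.range fun y : Fin n → ℕ => y + Pi.single i (y j))
      (Set.range ((fun y : Fin n → ℕ => y + Pi.single j (y i)) ∘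
        fun y : Fin n → ℕ => y + Pi.single j 1)) := by
  have mem_iff {i j : Fin n} (h : i ≠ j) (x : Fin n → ℕ) :
      x ∈ Set.range (fun y : Fin n → ℕ => y + Pi.single i (y j)) ↔ x j ≤ x i := by
    constructor
    · rintro ⟨y, rfl⟩
      simp [h.symm]
    · intro hx
      refine ⟨x - Pi.single i (x j), ?_⟩
      simp only [Pi.sub_apply, Pi.single_eq_of_ne h.symm, tsub_zero]
      refine tsub_add_cancel_of_le fun l => ?_
      rcases eq_or_ne l i with rfl | hl
      · simpa using hx
      · simp [hl]
  rw [← compl_eq_iff_isCompl]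
  ext x
  rw [Set.mem_compl_iff, mem_iff h, not_le]
  constructor
  · intro hx
    refine ⟨x - Pi.single j (x i) - Pi.single j 1, ?_⟩
    funext l
    rcases eq_or_ne l j with rfl | hl
    · simp [h]
      omega
    · simp [hl]
  · rintro ⟨y, rfl⟩
    simp [h]

theorem isSemisimple_of_abs_le_one {n : ℕ} (a : Fin n → ℤ) (ha : ∀ i, (a i).natAbs ≤ 1) (c : ℤ) :
    IsSemisimple {y : Fin n → ℕ | 0 ≤ c + ∑ i, a i * y i} := by
  have ih {m : ℕ} (b : Fin m → ℤ) (hb : ∀ i, (b i).natAbs ≤ 1)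
      (h : ∑ i, (b i).natAbs < ∑ i, (a i).natAbs) (c' : ℤ) :
      IsSemisimple {y : Fin m → ℕ | 0 ≤ c' + ∑ i, b i * y i} :=
    isSemisimple_of_abs_le_one b hb c'
  have ih' (c' : ℤ) (h : c'.natAbs < c.natAbs) :
      IsSemisimple {y : Fin n → ℕ | 0 ≤ c' + ∑ i, a i * y i} :=
    isSemisimple_of_abs_le_one a ha c'
  by_cases hpair : (∃ i, a i = 1) ∧ ∃ j, a j = -1
  · obtain ⟨⟨i, hi⟩, j, hj⟩ := hpair
    have hij : i ≠ j := by rintro rfl; omega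
    have decr {i : Fin n} {b : ℤ} (hb : (a i + b).natAbs < (a i).natAbs) :
        ∑ l, ((a + Pi.single i b : Fin n → ℤ) l).natAbs < ∑ l, (a l).natAbs := by
      refine Finset.sum_lt_sum (fun l _ => ?_) ⟨i, Finset.mem_univ i, by simpa using hb⟩
      rcases eq_or_ne l i with rfl | hl
      · simpa using hb.le
      · simp [hl]
    have le_one {i : Fin n} {b : ℤ} (hb : (a i + b).natAbs < (a i).natAbs) l :
        ((a + Pi.single i b : Fin n → ℤ) l).natAbs ≤ 1 := by
      rcases eq_or_ne l i with rfl | hl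
      · simpa using hb.le.trans (ha l)
      · simpa [hl] using ha l
    have hbj : (a j + 1).natAbs < (a j).natAbs := by simp [hj]
    have hbi : (a i + -1).natAbs < (a i).natAbs := by simp [hi]
    refine IsSemisimple.of_preimage (.add_single_apply hij)
      ((IsAffineEmbedding.add_single_apply hij.symm).comp (.add_single_one j))
      (isCompl_range_add_single hij) ?_ ?_
    · convert ih (a + Pi.single j 1) (le_one hbj) (decr hbj) c using 1
      ext y
      simp [mul_add, add_mul, Finset.sum_add_distrib, Pi.single_apply, hi]
    · convert ih (a + Pi.single i (-1)) (le_one hbi) (decr hbi) (c - 1) using 1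
      ext y
      simp [mul_add, add_mul, Finset.sum_add_distrib, Pi.single_apply, hj, hij]
      constructor <;> intro h <;> linarith
  have empty_of {c : ℤ} (hc : c < 0) (h : ∀ i, a i ≤ 0) :
      {y : Fin n → ℕ | 0 ≤ c + ∑ i, a i * y i} = ∅ := by
    refine Set.eq_empty_iff_forall_notMem.2 fun y hy => ?_
    have := Finset.sum_nonpos fun i (_ : i ∈ Finset.univ) =>
      mul_nonpos_of_nonpos_of_nonneg (h i) (Int.natCast_nonneg (y i))
    have hy : 0 ≤ c + ∑ i, a i * y i := hy
    omega
  have step (i) (hi : a i ≠ 0) (hic : a i = -1 ∧ 0 ≤ c ∨ a i = 1 ∧ c < 0) :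
      IsSemisimple {y : Fin n → ℕ | 0 ≤ c + ∑ i, a i * y i} := by
    obtain ⟨m, rfl⟩ : ∃ m, n = m + 1 := ⟨n - 1, by have := i.pos; omega⟩
    have hdecr : ∑ j, (a (i.succAbove j)).natAbs < ∑ j, (a j).natAbs := by
      rw [Fin.sum_univ_succAbove (fun j => (a j).natAbs) i]
      omega
    refine IsSemisimple.of_preimage (.insertNth_zero i) (.add_single_one i)
      (isCompl_range_insertNth_zero i) ?_ ?_
    · convert ih (fun j => a (i.succAbove j)) (fun j => ha _) hdecr c using 1
      ext y
      simp [Fin.sum_univ_succAbove _ i]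
    · have hshift : (fun y : Fin (m + 1) → ℕ => y + Pi.single i 1) ⁻¹'
          {y | 0 ≤ c + ∑ i, a i * y i} = {y | 0 ≤ (c + a i) + ∑ i, a i * y i} := by
        ext y
        simp [mul_add, Finset.sum_add_distrib, Pi.single_apply, add_assoc, add_comm (a i)]
      rw [hshift]
      by_cases hc : c = 0
      · rw [empty_of (by omega) fun j => ?_]
        · exact .empty
        · by_contra hj
          exact hpair ⟨⟨j, by have := ha j; omega⟩, i, by omega⟩
      · exact ih' (c + a i) (by omega)
  rcases le_or_gt 0 c with hc | hc
  · by_cases h : ∃ i, a i = -1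
    · obtain ⟨i, hi⟩ := h
      exact step i (by rw [hi]; decide) (.inl ⟨hi, hc⟩)
    · convert IsSemisimple.univ (n := n)
      refine Set.eq_univ_of_forall fun y => ?_
      refine add_nonneg hc (Finset.sum_nonneg fun i _ => mul_nonneg ?_ (Int.natCast_nonneg _))
      have := ha i
      have : a i ≠ -1 := fun h' => h ⟨i, h'⟩
      omega
  · by_cases h : ∃ i, a i = 1
    · obtain ⟨i, hi⟩ := h
      exact step i (by rw [hi]; decide) (.inr ⟨hi, hc⟩)
    · rw [empty_of hc fun i => ?_]
      · exact .empty
      · have := ha i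
        have : a i ≠ 1 := fun h' => h ⟨i, h'⟩
        omega
termination_by (∑ i, (a i).natAbs, c.natAbs)

theorem isSemisimple_halfSpace (a : Fin n → ℤ) (c : ℤ) :
    IsSemisimple {y : Fin n → ℕ | 0 ≤ c + ∑ i, a i * y i} := by
  set e : Fin n → ℕ := fun i => if a i = 0 then 1 else (a i).natAbs with he
  have he0 i : 0 < e i := by
    simp only [he]
    split_ifs <;> omega
  set d : Fin n → ℕ := fun i => ∏ j ∈ Finset.univ.erase i, e j
  set L : ℕ := ∏ j, e j
  have hL : 0 < (L : ℤ) := by exact_mod_cast Finset.prod_pos fun i _ => he0 i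
  have hd i : a i * d i = L * (a i).sign := by
    have hL' : e i * d i = L := Finset.mul_prod_erase _ _ (Finset.mem_univ i)
    rw [← hL']
    simp only [he]
    split_ifs with h
    · simp [h]
    · push_cast
      rw [mul_right_comm, mul_comm |a i|, Int.sign_mul_abs]
  refine .of_residues (d := d) (fun i => Finset.prod_pos fun j _ => he0 j) fun r => ?_
  convert isSemisimple_of_abs_le_one (fun i => (a i).sign)
    (fun i => by rw [Int.natAbs_sign]; split_ifs <;> omega) ((c + ∑ i, a i * r i) / L) using 1
  ext y
  have hsum : c + ∑ i, a i * ((r + d * y) i : ℕ) =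
      (c + ∑ i, a i * r i) + L * ∑ i, (a i).sign * y i := by
    simp only [Pi.add_apply, Pi.mul_apply, Nat.cast_add, Nat.cast_mul, mul_add,
      Finset.sum_add_distrib, Finset.mul_sum, ← mul_assoc, hd, add_assoc]
  rw [Set.mem_ofPred_eq, Set.mem_ofPred_eq, Set.mem_ofPred_eq, hsum,
    ← Int.add_mul_ediv_left _ _ hL.ne', Int.ediv_nonneg_iff_of_pos hL]

theorem isSemisimple_dvd (a : Fin n → ℤ) (c : ℤ) {b : ℕ} (hb : 0 < b) :
    IsSemisimple {y : Fin n → ℕ | (b : ℤ) ∣ c + ∑ i, a i * y i} ∧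
      IsSemisimple {y : Fin n → ℕ | ¬ (b : ℤ) ∣ c + ∑ i, a i * y i} := by
  have hdvd (r y : Fin n → ℕ) :
      (b : ℤ) ∣ c + ∑ i, a i * ((r + (fun _ => b) * y : Fin n → ℕ) i : ℕ) ↔
        (b : ℤ) ∣ c + ∑ i, a i * r i := by
    have hsum : c + ∑ i, a i * ((r + (fun _ => b) * y : Fin n → ℕ) i : ℕ) =
        (c + ∑ i, a i * r i) + b * ∑ i, a i * y i := by
      simp only [Pi.add_apply, Pi.mul_apply, Nat.cast_add, Nat.cast_mul, mul_add,
        Finset.sum_add_distrib, Finset.mul_sum, add_assoc, mul_left_comm]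
    rw [hsum, dvd_add_left (dvd_mul_right _ _)]
  have hconst (p : Prop) : IsSemisimple {_y : Fin n → ℕ | p} := by
    by_cases hp : p
    · simpa [hp] using IsSemisimple.univ
    · simpa [hp] using IsSemisimple.empty
  constructor <;> refine .of_residues (d := fun _ => b) (fun _ => hb) fun r => ?_ <;>
    simpa only [Set.mem_ofPred_eq, hdvd] using hconst _

end HalfSpace

/-- A set splits semisimple sets if it cuts each of them into two semisimple sets. -/
def SplitsSemisimple {n : ℕ} (T : Set (Fin n → ℕ)) : Prop :=
  ∀ S, IsSemisimple S → IsSemisimple (S ∩ T) ∧ IsSemisimple (S \ T)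

namespace SplitsSemisimple

variable {n : ℕ}

theorem compl {T : Set (Fin n → ℕ)} (hT : SplitsSemisimple T) : SplitsSemisimple Tᶜ :=
  fun S hS => by
    rw [Set.sdiff_compl, ← Set.sdiff_eq]
    exact (hT S hS).symm

theorem univ : SplitsSemisimple (Set.univ : Set (Fin n → ℕ)) :=
  fun S hS => by simpa using ⟨hS, IsSemisimple.empty⟩

theorem inter {T T' : Set (Fin n → ℕ)} (hT : SplitsSemisimple T) (hT' : SplitsSemisimple T') :
    SplitsSemisimple (T ∩ T') := fun S hS => by
  refine ⟨?_, ?_⟩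
  · rw [← Set.inter_assoc]
    exact (hT' _ (hT S hS).1).1
  · convert (hT S hS).2.union (hT' _ (hT S hS).1).2 ?_ using 1
    · ext x
      simp only [Set.mem_sdiff, Set.mem_inter_iff, Set.mem_union]
      tauto
    · rw [Set.disjoint_left]
      exact fun x hx hx' => hx.2 hx'.1.2

theorem iInter {m : ℕ} {T : Fin m → Set (Fin n → ℕ)} (hT : ∀ i, SplitsSemisimple (T i)) :
    SplitsSemisimple (⋂ i, T i) := by
  induction m with
  | zero => simpa using univ
  | succ m ih =>
    have h : ⋂ i, T i = T 0 ∩ ⋂ i : Fin m, T i.succ := by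
      ext x
      simp [Fin.forall_fin_succ]
    rw [h]
    exact (hT 0).inter (ih fun i => hT i.succ)

theorem iUnion {m : ℕ} {T : Fin m → Set (Fin n → ℕ)} (hT : ∀ i, SplitsSemisimple (T i)) :
    SplitsSemisimple (⋃ i, T i) := by
  simpa [Set.compl_iInter] using (iInter fun i => (hT i).compl).compl

/-- Whether a set defined by an affine form splits semisimple sets can be checked on `ℕ^m`. -/
theorem of_affine {P : ℤ → Prop}
    (h : ∀ {m : ℕ} (a : Fin m → ℤ) (c : ℤ),
      IsSemisimple {y : Fin m → ℕ | P (c + ∑ i, a i * y i)} ∧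
        IsSemisimple {y : Fin m → ℕ | ¬ P (c + ∑ i, a i * y i)})
    (u : Fin n → ℤ) : SplitsSemisimple {y : Fin n → ℕ | P (∑ i, u i * y i)} := by
  intro S hS
  induction hS with
  | empty => simpa using IsSemisimple.empty
  | @range m φ hφ =>
    obtain ⟨hinj, b, f, hf⟩ := hφ
    have hform (y) : ∑ i, u i * (φ y i : ℤ) =
        ∑ i, u i * b i + ∑ j, (∑ i, u i * f (Pi.single j 1) i) * y j := by
      have hfy : f y = ∑ j, y j • f (Pi.single j 1) := by
        conv_lhs => rw [← Finset.univ_sum_single y, map_sum]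
        refine Finset.sum_congr rfl fun j _ => ?_
        rw [← map_nsmul, ← Pi.single_smul, smul_eq_mul, mul_one]
      simp only [hf, hfy, Pi.add_apply, Finset.sum_apply, Pi.smul_apply, smul_eq_mul,
        Nat.cast_add, Nat.cast_sum, Nat.cast_mul, mul_add, Finset.sum_add_distrib,
        Finset.mul_sum, Finset.sum_mul]
      rw [Finset.sum_comm]
      congr 1
      refine Finset.sum_congr rfl fun j _ => Finset.sum_congr rfl fun i _ => ?_
      ring
    obtain ⟨h₁, h₂⟩ := h (fun j => ∑ i, u i * f (Pi.single j 1) i) (∑ i, u i * b i)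
    simp only [← hform] at h₁ h₂
    refine ⟨?_, ?_⟩
    · convert h₁.image ⟨hinj, b, f, hf⟩ using 1
      rw [Set.inter_comm, ← Set.image_preimage_eq_inter_range]
      rfl
    · convert h₂.image ⟨hinj, b, f, hf⟩ using 1
      rw [Set.sdiff_eq, Set.inter_comm, ← Set.image_preimage_eq_inter_range]
      rfl
  | union _ _ hd ihS ihT =>
    rw [Set.union_inter_distrib_right, Set.union_sdiff_distrib]
    exact ⟨ihS.1.union ihT.1 (hd.mono Set.inter_subset_left Set.inter_subset_left),
      ihS.2.union ihT.2 (hd.mono Set.sdiff_subset Set.sdiff_subset)⟩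

theorem lt (u : Fin n → ℤ) (a : ℤ) :
    SplitsSemisimple {y : Fin n → ℕ | a < ∑ i, u i * y i} := by
  refine of_affine (P := fun t => a < t) (fun v c => ⟨?_, ?_⟩) u
  · convert isSemisimple_halfSpace v (c - a - 1) using 1
    ext y
    simp only [Set.mem_ofPred_eq]
    constructor <;> intro h <;> linarith
  · convert isSemisimple_halfSpace (-v) (a - c) using 1
    ext y
    simp only [Set.mem_ofPred_eq, Pi.neg_apply, neg_mul, Finset.sum_neg_distrib]
    constructor <;> intro h <;> linarith

theorem eq (u : Fin n → ℤ) (a : ℤ) :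
    SplitsSemisimple {y : Fin n → ℕ | ∑ i, u i * y i = a} := by
  convert (lt u a).compl.inter (lt u (a - 1)) using 1
  ext y
  simp only [Set.mem_inter_iff, Set.mem_compl_iff, Set.mem_ofPred_eq]
  omega

theorem dvd (u : Fin n → ℤ) (a : ℤ) {b : ℕ} (hb : 0 < b) :
    SplitsSemisimple {y : Fin n → ℕ | (b : ℤ) ∣ ∑ i, u i * y i - a} := by
  refine of_affine (P := fun t => (b : ℤ) ∣ t - a) (fun v c => ?_) u
  convert isSemisimple_dvd v (c - a) hb using 6 <;> ring

end SplitsSemisimple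

theorem IsPolyhedral.splitsSemisimple {k : ℕ} {X : Set (Fin k → ℤ)} (hX : IsPolyhedral X) :
    SplitsSemisimple {y : Fin k → ℕ | (fun i => (y i : ℤ)) ∈ X} := by
  obtain ⟨m, B, hB, rfl⟩ := hX
  simp only [Set.mem_iUnion, Set.ofPred_exists]
  refine .iUnion fun i => ?_
  obtain ⟨l, E, hE, h⟩ := hB i
  simp only [h, Set.mem_iInter, Set.ofPred_forall]
  refine .iInter fun j => ?_
  obtain ⟨u, a, h⟩ | ⟨u, a, b, hb, h⟩ | ⟨u, a, h⟩ := hE j <;> rw [h]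
  · exact .eq u a
  · exact .dvd u a hb
  · exact .lt u a

/-- Let `k ∈ ℕ₊` and let `X ⊆ ℕ^k ⊆ ℤ^k` be a polyhedral set. Then the
growth series of `X` with respect to the `ℓ¹` metric,
`∑ₙ #{x ∈ X : |x|₁ ≤ n} zⁿ`, is a rational power series. -/
theorem polyhedral_growth_series_rational (k : ℕ) (hk : 0 < k)
    (X : Set (Fin k → ℤ)) (hX : IsPolyhedral X)
    (hXnn : ∀ x ∈ X, ∀ i, 0 ≤ x i) :
    ∃ p q : Polynomial ℚ, q.coeff 0 ≠ 0 ∧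
      (q : PowerSeries ℚ) *
          PowerSeries.mk
            (fun n => (Set.ncard {x : Fin k → ℤ | x ∈ X ∧ ∑ i, (x i).natAbs ≤ n} : ℚ)) =
        (p : PowerSeries ℚ) := by
  set S : Set (Fin k → ℕ) := {y | (fun i => (y i : ℤ)) ∈ X} with hS
  have h : IsSemisimple S := by simpa using (hX.splitsSemisimple _ .univ).1
  suffices heq : PowerSeries.mk (fun n =>
      (Set.ncard {x : Fin k → ℤ | x ∈ X ∧ ∑ i, (x i).natAbs ≤ n} : ℚ)) = growthSeries S by
    rw [heq]
    exact h.isRationalSeries_growthSeries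
  ext n
  rw [growthSeries, PowerSeries.coeff_mk, PowerSeries.coeff_mk]
  have hinj : Function.Injective fun (y : Fin k → ℕ) i => (y i : ℤ) := fun x y hxy =>
    funext fun i => Int.ofNat_inj.1 (congrFun hxy i)
  rw [← Set.ncard_image_of_injective {x ∈ S | _} hinj]
  congr 2
  ext x
  simp only [hS, Set.mem_ofPred_eq, Set.mem_image]
  constructor
  · rintro ⟨hx, hn⟩
    have hx' : (fun i => ((x i).natAbs : ℤ)) = x :=
      funext fun i => Int.natAbs_of_nonneg (hXnn x hx i)
    exact ⟨fun i => (x i).natAbs, ⟨by rwa [hx'], hn⟩, hx'⟩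
  · rintro ⟨y, ⟨hy, hn⟩, rfl⟩
    exact ⟨hy, by simpa using hn⟩
end

section
/- Let k, l ∈ ℕ₊, let X be a polyhedral subset of ℤ^k, and let φ : ℤ^k → ℤ^l be an integral affine transformation. Then the image φ(X) is a polyhedral subset of ℤ^l. -/
/-- The projection of `S ⊆ ℤ^(k+1)` forgetting the last coordinate. -/
def projLast {k : ℕ} (S : Set (Fin (k + 1) → ℤ)) : Set (Fin k → ℤ) :=
  {z | ∃ t : ℤ, (Fin.snoc z t : Fin (k + 1) → ℤ) ∈ S}

theorem isElementary_eq {k : ℕ} (u : Fin k → ℤ) (a : ℤ) :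
    IsElementary {z : Fin k → ℤ | ∑ i, u i * z i = a} :=
  Or.inl ⟨u, a, rfl⟩

theorem isElementary_dvd {k : ℕ} (u : Fin k → ℤ) (a b : ℤ) (hb : b ≠ 0) :
    IsElementary {z : Fin k → ℤ | b ∣ (∑ i, u i * z i) - a} :=
  Or.inr (Or.inl ⟨u, a, b.natAbs, Int.natAbs_pos.mpr hb, by simp⟩)

theorem isElementary_lt {k : ℕ} (u : Fin k → ℤ) (a : ℤ) :
    IsElementary {z : Fin k → ℤ | a < ∑ i, u i * z i} :=
  Or.inr (Or.inr ⟨u, a, rfl⟩)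

theorem isBasicPolyhedral_iInter_of_isElementary {k : ℕ} {ι : Type*} [Finite ι]
    {E : ι → Set (Fin k → ℤ)} (hE : ∀ i, IsElementary (E i)) :
    IsBasicPolyhedral (⋂ i, E i) := by
  obtain ⟨n, ⟨e⟩⟩ := Finite.exists_equiv_fin ι
  exact ⟨n, fun i => E (e.symm i), fun i => hE _, (e.symm.surjective.iInter_comp E).symm⟩

theorem IsBasicPolyhedral.iInter {k : ℕ} {ι : Type*} [Finite ι]
    {B : ι → Set (Fin k → ℤ)} (hB : ∀ i, IsBasicPolyhedral (B i)) :
    IsBasicPolyhedral (⋂ i, B i) := by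
  choose n E hE hBE using hB
  have h : ⋂ i, B i = ⋂ p : (Σ i, Fin (n i)), E p.1 p.2 := by
    simp only [hBE, Set.iInter_sigma]
  rw [h]
  exact isBasicPolyhedral_iInter_of_isElementary fun p => hE p.1 p.2

theorem isPolyhedral_iUnion_of_isBasicPolyhedral {k : ℕ} {ι : Type*} [Finite ι]
    {B : ι → Set (Fin k → ℤ)} (hB : ∀ i, IsBasicPolyhedral (B i)) :
    IsPolyhedral (⋃ i, B i) := by
  obtain ⟨n, ⟨e⟩⟩ := Finite.exists_equiv_fin ι
  exact ⟨n, fun i => B (e.symm i), fun i => hB _, (e.symm.surjective.iUnion_comp B).symm⟩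

theorem IsPolyhedral.iUnion {k : ℕ} {ι : Type*} [Finite ι]
    {S : ι → Set (Fin k → ℤ)} (hS : ∀ i, IsPolyhedral (S i)) :
    IsPolyhedral (⋃ i, S i) := by
  choose n B hB hSB using hS
  have h : ⋃ i, S i = ⋃ p : (Σ i, Fin (n i)), B p.1 p.2 := by
    simp only [hSB, Set.iUnion_sigma]
  rw [h]
  exact isPolyhedral_iUnion_of_isBasicPolyhedral fun p => hB p.1 p.2

theorem IsPolyhedral.iInter {k : ℕ} {ι : Type*} [Finite ι]
    {S : ι → Set (Fin k → ℤ)} (hS : ∀ i, IsPolyhedral (S i)) :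
    IsPolyhedral (⋂ i, S i) := by
  choose n B hB hSB using hS
  have h : ⋂ i, S i = ⋃ f : (∀ i, Fin (n i)), ⋂ i, B i (f i) := by
    ext x
    simp only [hSB, Set.mem_iInter, Set.mem_iUnion]
    exact Classical.skolem
  rw [h]
  exact isPolyhedral_iUnion_of_isBasicPolyhedral fun f => IsBasicPolyhedral.iInter fun i => hB i _

theorem IsBasicPolyhedral.isPolyhedral {k : ℕ} {S : Set (Fin k → ℤ)} (hS : IsBasicPolyhedral S) :
    IsPolyhedral S := by
  simpa only [Set.iUnion_const] using
    isPolyhedral_iUnion_of_isBasicPolyhedral (ι := Unit) fun _ => hS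

theorem IsElementary.isPolyhedral {k : ℕ} {S : Set (Fin k → ℤ)} (hS : IsElementary S) :
    IsPolyhedral S := by
  simpa only [Set.iInter_const] using
    (isBasicPolyhedral_iInter_of_isElementary (ι := Unit) fun _ => hS).isPolyhedral

theorem isPolyhedral_univ {k : ℕ} : IsPolyhedral (Set.univ : Set (Fin k → ℤ)) := by
  simpa using IsPolyhedral.iInter (ι := Empty) (S := fun _ => (Set.univ : Set (Fin k → ℤ)))
    fun i => i.elim

theorem isPolyhedral_empty {k : ℕ} : IsPolyhedral (∅ : Set (Fin k → ℤ)) := by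
  simpa using IsPolyhedral.iUnion (ι := Empty) (S := fun _ => (∅ : Set (Fin k → ℤ)))
    fun i => i.elim

theorem IsPolyhedral.inter {k : ℕ} {S T : Set (Fin k → ℤ)} (hS : IsPolyhedral S)
    (hT : IsPolyhedral T) : IsPolyhedral (S ∩ T) := by
  rw [Set.inter_eq_iInter]
  exact IsPolyhedral.iInter fun b => by cases b <;> assumption

theorem IsPolyhedral.union {k : ℕ} {S T : Set (Fin k → ℤ)} (hS : IsPolyhedral S)
    (hT : IsPolyhedral T) : IsPolyhedral (S ∪ T) := by
  rw [Set.union_eq_iUnion]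
  exact IsPolyhedral.iUnion fun b => by cases b <;> assumption

theorem sum_mul_snoc {k : ℕ} (u : Fin (k + 1) → ℤ) (z : Fin k → ℤ) (t : ℤ) :
    ∑ i, u i * (Fin.snoc z t : Fin (k + 1) → ℤ) i =
      ∑ i : Fin k, u i.castSucc * z i + u (Fin.last k) * t := by
  simp [Fin.sum_univ_castSucc]

/-- Substituting into an elementary set the integer `t` determined by `c * t + v·z = e` gives,
where such a `t` exists, an elementary condition on `z`. -/
theorem IsElementary.exists_substitution {k : ℕ} {E : Set (Fin (k + 1) → ℤ)} (hE : IsElementary E)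
    (v : Fin k → ℤ) (c e : ℤ) (hc : c ≠ 0) :
    ∃ F : Set (Fin k → ℤ), IsElementary F ∧ ∀ z t, ∑ i, v i * z i + c * t = e →
      ((Fin.snoc z t : Fin (k + 1) → ℤ) ∈ E ↔ z ∈ F) := by
  have hc2 : 0 < c ^ 2 := by positivity
  have key : ∀ (u : Fin (k + 1) → ℤ) (z : Fin k → ℤ) (t : ℤ), ∑ i, v i * z i + c * t = e →
      ∑ i, (c ^ 2 * u i.castSucc - c * u (Fin.last k) * v i) * z i =
        c ^ 2 * (∑ i : Fin k, u i.castSucc * z i + u (Fin.last k) * t)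
          - c * u (Fin.last k) * e := by
    intro u z t h
    simp only [sub_mul, Finset.sum_sub_distrib, mul_assoc, ← Finset.mul_sum]
    rw [← h]
    ring
  rcases hE with ⟨u, a, rfl⟩ | ⟨u, a, b, hb, rfl⟩ | ⟨u, a, rfl⟩
  · refine ⟨_, isElementary_eq (fun i => c ^ 2 * u i.castSucc - c * u (Fin.last k) * v i)
      (c ^ 2 * a - c * u (Fin.last k) * e), fun z t h => ?_⟩
    simp only [Set.mem_ofPred_eq, sum_mul_snoc, key u z t h, sub_left_inj,
      mul_right_inj' hc2.ne']
  · refine ⟨_, isElementary_dvd (fun i => c ^ 2 * u i.castSucc - c * u (Fin.last k) * v i)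
      (c ^ 2 * a - c * u (Fin.last k) * e) (c ^ 2 * b) (by positivity), fun z t h => ?_⟩
    simp only [Set.mem_ofPred_eq, sum_mul_snoc, key u z t h, sub_sub_sub_cancel_right, ← mul_sub,
      mul_dvd_mul_iff_left hc2.ne']
  · refine ⟨_, isElementary_lt (fun i => c ^ 2 * u i.castSucc - c * u (Fin.last k) * v i)
      (c ^ 2 * a - c * u (Fin.last k) * e), fun z t h => ?_⟩
    simp only [Set.mem_ofPred_eq, sum_mul_snoc, key u z t h, sub_lt_sub_iff_right,
      mul_lt_mul_iff_right₀ hc2]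

theorem isPolyhedral_exists_snoc_mem_iInter {k : ℕ} {ι : Type*} [Finite ι]
    {E : ι → Set (Fin (k + 1) → ℤ)} (hE : ∀ i, IsElementary (E i))
    (v : Fin k → ℤ) (c e : ℤ) (hc : c ≠ 0) :
    IsPolyhedral {z : Fin k → ℤ | ∃ t : ℤ, ∑ i, v i * z i + c * t = e ∧
      (Fin.snoc z t : Fin (k + 1) → ℤ) ∈ ⋂ i, E i} := by
  choose F hF hEF using fun i => (hE i).exists_substitution v c e hc
  convert (isElementary_dvd v e c hc).isPolyhedral.inter
    (IsPolyhedral.iInter fun i => (hF i).isPolyhedral) using 1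
  ext z
  simp only [Set.mem_ofPred_eq, Set.mem_iInter, Set.mem_inter_iff]
  constructor
  · rintro ⟨t, ht, h⟩
    exact ⟨⟨-t, by linarith⟩, fun i => (hEF i z t ht).1 (h i)⟩
  · rintro ⟨⟨t, ht⟩, h⟩
    have ht' : ∑ i, v i * z i + c * -t = e := by linarith
    exact ⟨-t, ht', fun i => (hEF i z _ ht').2 (h i)⟩

open Filter in
/-- Along downward steps in the last coordinate, whose length is a multiple of the modulus, an
elementary set is eventually a polyhedral condition, and it can be left only at points lying on
one of finitely many hyperplanes transversal to the last coordinate. -/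
theorem IsElementary.exists_period {k : ℕ} {E : Set (Fin (k + 1) → ℤ)} (hE : IsElementary E) :
    ∃ m : ℕ, 0 < m ∧ ∀ M : ℕ, 0 < M → m ∣ M →
      (∀ d : ℤ, IsPolyhedral {z : Fin k → ℤ | ∀ᶠ n : ℕ in atTop,
        (Fin.snoc z (d - M * n) : Fin (k + 1) → ℤ) ∈ E}) ∧
      ∃ (v : Fin k → ℤ) (c : ℤ) (K : Finset ℤ), c ≠ 0 ∧ ∀ (z : Fin k → ℤ) (t : ℤ),
        (Fin.snoc z t : Fin (k + 1) → ℤ) ∈ E → (Fin.snoc z (t - M) : Fin (k + 1) → ℤ) ∉ E →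
          ∑ i, v i * z i + c * t ∈ K := by
  rcases hE with ⟨u, a, rfl⟩ | ⟨u, a, b, hb, rfl⟩ | ⟨u, a, rfl⟩
  · refine ⟨1, one_pos, fun M hM _ => ?_⟩
    simp only [Set.mem_ofPred_eq, sum_mul_snoc]
    by_cases hc : u (Fin.last k) = 0
    · refine ⟨fun d => ?_, 0, 1, ∅, one_ne_zero, fun z t h h' => ?_⟩
      · simpa only [hc, zero_mul, add_zero, eventually_const] using
          (isElementary_eq (fun i : Fin k => u i.castSucc) a).isPolyhedral
      · simp_all
    · refine ⟨fun d => ?_, fun i => u i.castSucc, u (Fin.last k), {a}, hc,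
        fun z t h h' => by simpa using h⟩
      convert isPolyhedral_empty using 1
      rw [Set.eq_empty_iff_forall_notMem]
      intro z hz
      obtain ⟨N, hN⟩ := eventually_atTop.1 hz
      have h1 := hN N le_rfl
      have h2 := hN (N + 1) (by simp)
      have h3 : u (Fin.last k) * (M : ℤ) = 0 := by
        push_cast at h2
        linarith
      rcases mul_eq_zero.1 h3 with h | h
      · exact hc h
      · omega
  · refine ⟨b, hb, fun M hM hbM => ?_⟩
    have hbM' : (b : ℤ) ∣ M := by exact_mod_cast hbM
    have key : ∀ s c d n : ℤ, (b : ℤ) ∣ s + c * (d - M * n) - a ↔ (b : ℤ) ∣ s - (a - c * d) := by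
      intro s c d n
      have h : s + c * (d - M * n) - a = s - (a - c * d) - M * (c * n) := by ring
      rw [h]
      exact dvd_sub_left (hbM'.mul_right _)
    simp only [Set.mem_ofPred_eq, sum_mul_snoc, key]
    refine ⟨fun d => ?_, 0, 1, ∅, one_ne_zero, fun z t h h' => ?_⟩
    · simpa only [eventually_const] using (isElementary_dvd (fun i : Fin k => u i.castSucc)
        (a - u (Fin.last k) * d) b (by positivity)).isPolyhedral
    · have h0 := key (∑ i : Fin k, u i.castSucc * z i) (u (Fin.last k)) t 0
      have h1 := key (∑ i : Fin k, u i.castSucc * z i) (u (Fin.last k)) t 1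
      rw [mul_zero, sub_zero] at h0
      rw [mul_one] at h1
      exact absurd (h1.2 (h0.1 h)) h'
  · refine ⟨1, one_pos, fun M hM _ => ?_⟩
    have hM' : (1 : ℤ) ≤ M := by exact_mod_cast hM
    simp only [Set.mem_ofPred_eq, sum_mul_snoc]
    rcases lt_trichotomy (u (Fin.last k)) 0 with hc | hc | hc
    · refine ⟨fun d => ?_, 0, 1, ∅, one_ne_zero, fun z t h h' => ?_⟩
      · convert isPolyhedral_univ using 1
        rw [Set.eq_univ_iff_forall]
        intro z
        set s := ∑ i : Fin k, u i.castSucc * z i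
        refine eventually_atTop.2 ⟨(a - s - u (Fin.last k) * d).toNat + 1, fun n hn => ?_⟩
        have h1 : a - s - u (Fin.last k) * d < n := by omega
        have h2 : (1 : ℤ) ≤ -u (Fin.last k) * M := by nlinarith
        have h3 : (n : ℤ) ≤ -u (Fin.last k) * M * n := le_mul_of_one_le_left (by positivity) h2
        linarith
      · exact absurd (by nlinarith) h'
    · refine ⟨fun d => ?_, 0, 1, ∅, one_ne_zero, fun z t h h' => ?_⟩
      · simpa only [hc, zero_mul, add_zero, eventually_const] using
          (isElementary_lt (fun i : Fin k => u i.castSucc) a).isPolyhedral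
      · simp_all
    · refine ⟨fun d => ?_, fun i => u i.castSucc, u (Fin.last k),
        Finset.Icc a (a + u (Fin.last k) * M), hc.ne', fun z t h h' => ?_⟩
      · convert isPolyhedral_empty using 1
        rw [Set.eq_empty_iff_forall_notMem]
        intro z hz
        set s := ∑ i : Fin k, u i.castSucc * z i
        obtain ⟨N, hN⟩ := eventually_atTop.1 hz
        have h0 := hN (N + (s + u (Fin.last k) * d - a).toNat) (by simp)
        set n := N + (s + u (Fin.last k) * d - a).toNat
        have h1 : s + u (Fin.last k) * d - a ≤ n := by omega
        have h2 : (1 : ℤ) ≤ u (Fin.last k) * M := by nlinarith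
        have h3 : (n : ℤ) ≤ u (Fin.last k) * M * n := le_mul_of_one_le_left (by positivity) h2
        linarith
      · rw [Finset.mem_Icc]
        constructor <;> linarith

open Filter in
theorem IsBasicPolyhedral.projLast {k : ℕ} {S : Set (Fin (k + 1) → ℤ)}
    (hS : IsBasicPolyhedral S) : IsPolyhedral (projLast S) := by
  obtain ⟨N, E, hE, rfl⟩ := hS
  choose m hm hmE using fun i => (hE i).exists_period
  have hM : 0 < ∏ i, m i := Finset.prod_pos fun i _ => hm i
  choose hlim v c K hc hK using fun i => hmE i (∏ i, m i) hM (Finset.dvd_prod_of_mem m (by simp))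
  generalize (∏ i, m i) = M at hM hlim hK
  have hlim' : ∀ d : ℤ, IsPolyhedral {z : Fin k → ℤ | ∀ᶠ n : ℕ in atTop,
      (Fin.snoc z (d - M * n) : Fin (k + 1) → ℤ) ∈ ⋂ i, E i} := by
    intro d
    convert IsPolyhedral.iInter fun i => hlim i d using 1
    ext z
    simp only [Set.mem_ofPred_eq, Set.mem_iInter, eventually_all]
  convert (IsPolyhedral.iUnion fun d : Fin M => hlim' d).union
    (IsPolyhedral.iUnion fun p : (Σ i, K i) =>
      isPolyhedral_exists_snoc_mem_iInter hE (v p.1) (c p.1) p.2 (hc p.1)) using 1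
  ext z
  simp only [Set.mem_union, Set.mem_iUnion, Set.mem_ofPred_eq]
  constructor
  · rintro ⟨t, ht⟩
    by_cases hall : ∀ n : ℕ, (Fin.snoc z (t - M * n) : Fin (k + 1) → ℤ) ∈ ⋂ i, E i
    · left
      have hM' : (0 : ℤ) < M := by exact_mod_cast hM
      have h0 := Int.emod_nonneg t hM'.ne'
      have h1 := Int.emod_lt_of_pos t hM'
      refine ⟨⟨(t % M).toNat, by omega⟩, eventually_atTop.2 ⟨(t / M).natAbs, fun n hn => ?_⟩⟩
      have h2 := hall (n + t / M).toNat
      have h3 : ((n + t / M).toNat : ℤ) = n + t / M := Int.toNat_of_nonneg (by omega)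
      have h4 := Int.emod_add_mul_ediv t M
      have h5 : t - M * (n + t / M) = t % M - M * n := by linarith
      rw [h3, h5] at h2
      simpa only [Int.toNat_of_nonneg h0] using h2
    · right
      have hstep : ∃ n : ℕ, (Fin.snoc z (t - M * n) : Fin (k + 1) → ℤ) ∈ (⋂ i, E i) ∧
          (Fin.snoc z (t - M * (n + 1 : ℕ)) : Fin (k + 1) → ℤ) ∉ ⋂ i, E i := by
        by_contra! hcon
        exact hall fun n => Nat.rec (by simpa using ht) hcon n
      obtain ⟨n, hn, hn'⟩ := hstep
      rw [Set.mem_iInter, not_forall] at hn'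
      obtain ⟨i, hi⟩ := hn'
      have h : t - M * (n + 1 : ℕ) = t - M * n - M := by push_cast; ring
      rw [h] at hi
      exact ⟨⟨i, ⟨_, hK i z _ (Set.mem_iInter.1 hn i) hi⟩⟩, _, rfl, hn⟩
  · rintro (⟨d, hd⟩ | ⟨p, t, -, ht⟩)
    · obtain ⟨n, hn⟩ := hd.exists
      exact ⟨_, hn⟩
    · exact ⟨t, ht⟩

theorem IsPolyhedral.projLast {k : ℕ} {S : Set (Fin (k + 1) → ℤ)} (hS : IsPolyhedral S) :
    IsPolyhedral (projLast S) := by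
  obtain ⟨n, B, hB, rfl⟩ := hS
  convert IsPolyhedral.iUnion fun i => (hB i).projLast using 1
  ext z
  simp only [_root_.projLast, Set.mem_iUnion, Set.mem_ofPred_eq]
  exact exists_comm

theorem IsPolyhedral.image_comp_castAdd {l : ℕ} (k : ℕ) {S : Set (Fin (l + k) → ℤ)}
    (hS : IsPolyhedral S) : IsPolyhedral ((fun w i => w (Fin.castAdd k i)) '' S) := by
  induction k with
  | zero => simpa using hS
  | succ k ih =>
    convert ih hS.projLast using 1
    ext y
    constructor
    · rintro ⟨w, hw, rfl⟩
      refine ⟨Fin.init (n := l + k) (α := fun _ => ℤ) w, ⟨w (Fin.last (l + k)), ?_⟩, rfl⟩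
      simpa only [Fin.snoc_init_self (n := l + k) (α := fun _ => ℤ) w] using hw
    · rintro ⟨w, ⟨t, ht⟩, rfl⟩
      refine ⟨_, ht, funext fun i => ?_⟩
      exact Fin.snoc_castSucc (n := l + k) (α := fun _ => ℤ) t w (Fin.castAdd k i)

theorem IsElementary.preimage_comp_natAdd {k : ℕ} (l : ℕ) {E : Set (Fin k → ℤ)}
    (hE : IsElementary E) :
    IsElementary ((fun (w : Fin (l + k) → ℤ) i => w (Fin.natAdd l i)) ⁻¹' E) := by
  have key : ∀ (u : Fin k → ℤ) (w : Fin (l + k) → ℤ),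
      ∑ i, Fin.append (0 : Fin l → ℤ) u i * w i = ∑ i, u i * w (Fin.natAdd l i) := by
    intro u w
    simp [Fin.sum_univ_add]
  rcases hE with ⟨u, a, rfl⟩ | ⟨u, a, b, hb, rfl⟩ | ⟨u, a, rfl⟩
  · simpa only [key, Set.preimage_ofPred_eq] using isElementary_eq (Fin.append (0 : Fin l → ℤ) u) a
  · simpa only [key, Set.preimage_ofPred_eq] using isElementary_dvd (Fin.append (0 : Fin l → ℤ) u) a b (by positivity)
  · simpa only [key, Set.preimage_ofPred_eq] using isElementary_lt (Fin.append (0 : Fin l → ℤ) u) a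

theorem IsPolyhedral.preimage_comp_natAdd {k : ℕ} (l : ℕ) {S : Set (Fin k → ℤ)}
    (hS : IsPolyhedral S) :
    IsPolyhedral ((fun (w : Fin (l + k) → ℤ) i => w (Fin.natAdd l i)) ⁻¹' S) := by
  obtain ⟨n, B, hB, rfl⟩ := hS
  choose m E hE hBE using hB
  simp only [hBE, Set.preimage_iUnion, Set.preimage_iInter]
  exact isPolyhedral_iUnion_of_isBasicPolyhedral fun i =>
    isBasicPolyhedral_iInter_of_isElementary fun j => (hE i j).preimage_comp_natAdd l

/-- If `X ⊆ ℤ^k` is polyhedral and `φ : ℤ^k → ℤ^l` is an integral affine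
transformation (`φ x = A x + b` for an integer matrix `A` and vector `b`), then the image
`φ '' X` is a polyhedral subset of `ℤ^l`. -/
theorem polyhedral_image_affine (k l : ℕ) (hk : 0 < k) (hl : 0 < l)
    (X : Set (Fin k → ℤ)) (hX : IsPolyhedral X)
    (φ : (Fin k → ℤ) → (Fin l → ℤ))
    (hφ : ∃ (A : Matrix (Fin l) (Fin k) ℤ) (b : Fin l → ℤ),
      ∀ x : Fin k → ℤ, φ x = A.mulVec x + b) :
    IsPolyhedral (φ '' X) := by
  obtain ⟨A, b, hφ⟩ := hφ
  have hgraph : ∀ i : Fin l, IsPolyhedral {w : Fin (l + k) → ℤ |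
      w (Fin.castAdd k i) = φ (fun j => w (Fin.natAdd l j)) i} := by
    intro i
    convert (isElementary_eq (Fin.append (Pi.single i 1) (-A i)) (b i)).isPolyhedral using 1
    ext w
    have h : ∑ j, Fin.append (Pi.single i 1) (-A i) j * w j =
        w (Fin.castAdd k i) - ∑ j, A i j * w (Fin.natAdd l j) := by
      simp [Fin.sum_univ_add, Pi.single_apply, sub_eq_add_neg]
    simp only [Set.mem_ofPred_eq, h, hφ, Pi.add_apply, Matrix.mulVec, dotProduct]
    exact sub_eq_iff_eq_add'.symm
  convert ((hX.preimage_comp_natAdd l).inter (IsPolyhedral.iInter hgraph)).image_comp_castAdd k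
    using 1
  ext y
  constructor
  · rintro ⟨x, hx, rfl⟩
    refine ⟨Fin.append (φ x) x, ⟨?_, ?_⟩, ?_⟩
    · simpa using hx
    · simp
    · simp
  · rintro ⟨w, ⟨hw, hw'⟩, rfl⟩
    exact ⟨_, hw, funext fun i => (Set.mem_iInter.1 hw' i).symm⟩
end
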